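/- Let p be a prime and n, k ≥ 1 with p^{n−1} ∣ k, and set m = k(p−1). Then the set of f ∈ R_n such that ψ_m^{(ℓ)}(f) = f for every integer ℓ ≥ 1 coprime to p equals the ℤ-span of {Z_1, …, Z_n}. (Equivalently, the subgroup of π_{0,2k(p−1)}KU_{C_{p^n}} fixed by all Adams operations is I(C_{p^n})·β_{k(p−1)}, where I(C_{p^n}) is the augmentation ideal of the Burnside ring.) -/

import Mathlib

open Polynomial

noncomputable section

/-- The ring `R_n = ℤ[X]/(X^{p^n} - 1)`, the complex representation ring `RU(C_{p^n})`. -/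
abbrev Rring (p n : ℕ) : Type :=
  Polynomial ℤ ⧸ Ideal.span {(X : Polynomial ℤ) ^ p ^ n - 1}

/-- The residue class `x` of `X` in `R_n`. -/
def xcl (p n : ℕ) : Rring p n := Ideal.Quotient.mk _ X

theorem xcl_pow (p n : ℕ) : xcl p n ^ p ^ n = 1 := by
  unfold xcl
  have hmem : ((X : Polynomial ℤ) ^ p ^ n - 1) ∈
      Ideal.span {(X : Polynomial ℤ) ^ p ^ n - 1} :=
    Ideal.subset_span (Set.mem_singleton _)
  have h0 := Ideal.Quotient.eq_zero_iff_mem.mpr hmem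
  rw [map_sub, map_pow, map_one] at h0
  exact sub_eq_zero.mp h0

/-- `x` as a unit of `R_n` (its inverse is `x^{p^n - 1}`). -/
def xunit (p n : ℕ) (hp : 0 < p) : (Rring p n)ˣ :=
  Units.mkOfMulEqOne (xcl p n) (xcl p n ^ (p ^ n - 1)) (by
    have h1 : p ^ n - 1 + 1 = p ^ n := by
      have := pow_pos hp n; omega
    calc xcl p n * xcl p n ^ (p ^ n - 1) = xcl p n ^ (p ^ n - 1 + 1) := by ring
      _ = 1 := by rw [h1, xcl_pow])

/-- `x^d` for an arbitrary integer `d` (using that `x` is a unit of `R_n`). -/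
def xz (p n : ℕ) (hp : 0 < p) (d : ℤ) : Rring p n :=
  ((xunit p n hp ^ d : (Rring p n)ˣ) : Rring p n)

/-- `T_i = Σ_{t=0}^{p^{n-i}-1} x^{t·p^i}`, the class of the transitive
`C_{p^n}`-set `C_{p^n}/C_{p^i}` under the marks isomorphism. -/
def Tel (p n i : ℕ) : Rring p n :=
  ∑ t ∈ Finset.range (p ^ (n - i)), xcl p n ^ (t * p ^ i)

/-- `Z_0 = p·T_0` and `Z_i = p·T_i - T_{i-1}` for `i ≥ 1`. -/
def Zel (p n i : ℕ) : Rring p n :=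
  if i = 0 then (p : Rring p n) * Tel p n 0
  else (p : Rring p n) * Tel p n i - Tel p n (i - 1)

end

/-- `acopr p t` is the `t`-th (1-indexed) positive integer coprime to `p`,
i.e. the increasing enumeration `a_1 < a_2 < ⋯` of positive integers coprime to `p`. -/
noncomputable def acopr (p t : ℕ) : ℕ :=
  Nat.nth (fun k => 0 < k ∧ Nat.Coprime k p) (t - 1)

/-- The sequence `d_1, d_2, …` given by `d_{2t-1} = a_t` and `d_{2t} = -a_t`. -/
noncomputable def dseq (p j : ℕ) : ℤ :=
  if j % 2 = 1 then (acopr p ((j + 1) / 2) : ℤ) else -(acopr p (j / 2) : ℤ)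

open Polynomial in
/-- The ring homomorphism `σ_ℓ : R_n → R_n` determined by `x ↦ x^ℓ` (well defined
since `(x^ℓ)^{p^n} = 1`). -/
noncomputable def sigmaHom (p n ℓ : ℕ) : Rring p n →+* Rring p n :=
  Ideal.Quotient.lift _ (aeval (R := ℤ) (xcl p n ^ ℓ)).toRingHom (by
    intro f hf
    obtain ⟨g, rfl⟩ := Ideal.mem_span_singleton.mp hf
    have h : (aeval (R := ℤ) (xcl p n ^ ℓ)) ((X : Polynomial ℤ) ^ p ^ n - 1) = 0 := by
      rw [map_sub, map_pow, aeval_X, map_one, ← pow_mul, mul_comm ℓ (p ^ n), pow_mul,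
        xcl_pow, one_pow, sub_self]
    simp only [AlgHom.toRingHom_eq_coe, RingHom.coe_coe, map_mul, h, zero_mul])

/-- `u_m^{(ℓ)} = ∏_{j=1}^m (Σ_{i=0}^{ℓ-1} x^{i·d_j}) ∈ R_n`; the Adams operation `ψ^ℓ`
on `π_{0,2m}KU_{C_{p^n}} ≅ R_n·β_m` is `f ↦ σ_ℓ(f)·u_m^{(ℓ)}`. -/
noncomputable def useq (p n : ℕ) (hp : 0 < p) (ℓ m : ℕ) : Rring p n :=
  ∏ j ∈ Finset.Icc 1 m, ∑ i ∈ Finset.range ℓ, xz p n hp ((i : ℤ) * dseq p j)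

/-! ### Coordinates in `R_n` -/

theorem Rring.ringHom_ext {p n : ℕ} {S : Type*} [Ring S] {f g : Rring p n →+* S}
    (h : f (xcl p n) = g (xcl p n)) : f = g := by
  refine Ideal.Quotient.ringHom_ext (Polynomial.ringHom_ext (fun a => ?_) h)
  simp

/-- The augmentation `R_n → ℤ`, `x ↦ 1`. -/
noncomputable def augHom (p n : ℕ) : Rring p n →+* ℤ :=
  Ideal.Quotient.lift _ (Polynomial.evalRingHom 1) (by
    intro f hf
    obtain ⟨g, rfl⟩ := Ideal.mem_span_singleton.mp hf
    simp)

theorem augHom_xcl (p n : ℕ) : augHom p n (xcl p n) = 1 := by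
  simp [augHom, xcl]

/-- The map from `R_n` to the group ring of `ℤ/p^n` sending `x` to the canonical generator. -/
noncomputable def toGroupRing (p n : ℕ) : Rring p n →+* AddMonoidAlgebra ℤ (ZMod (p ^ n)) :=
  Ideal.Quotient.lift _
    (Polynomial.aeval (R := ℤ) (AddMonoidAlgebra.single (1 : ZMod (p ^ n)) (1 : ℤ))).toRingHom (by
    intro f hf
    obtain ⟨g, rfl⟩ := Ideal.mem_span_singleton.mp hf
    have h : Polynomial.aeval (R := ℤ) (AddMonoidAlgebra.single (1 : ZMod (p ^ n)) (1 : ℤ))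
        ((Polynomial.X : Polynomial ℤ) ^ p ^ n - 1) = 0 := by
      rw [map_sub, map_pow, Polynomial.aeval_X, map_one, AddMonoidAlgebra.single_pow,
        AddMonoidAlgebra.one_def]
      simp only [nsmul_eq_mul, mul_one, one_pow, ZMod.natCast_self, sub_self]
    simp only [AlgHom.toRingHom_eq_coe, RingHom.coe_coe, map_mul, h, zero_mul])

theorem toGroupRing_xcl (p n : ℕ) :
    toGroupRing p n (xcl p n) = AddMonoidAlgebra.single 1 1 := by
  simp [toGroupRing, xcl]

theorem sigmaHom_xcl (p n ℓ : ℕ) : sigmaHom p n ℓ (xcl p n) = xcl p n ^ ℓ := by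
  simp [sigmaHom, xcl]

theorem xcl_pow_mod (p n a : ℕ) : xcl p n ^ (a % p ^ n) = xcl p n ^ a := by
  conv_rhs => rw [← Nat.mod_add_div a (p ^ n), pow_add, pow_mul, xcl_pow, one_pow, mul_one]

theorem xcl_pow_val_natCast (p n a : ℕ) :
    xcl p n ^ (a : ZMod (p ^ n)).val = xcl p n ^ a := by
  rw [ZMod.val_natCast, xcl_pow_mod]

section

variable {p n : ℕ} [NeZero (p ^ n)]

/-- The coefficient of `x^a` in an element of `R_n`. -/
noncomputable def rcoeff (f : Rring p n) (a : ZMod (p ^ n)) : ℤ := (toGroupRing p n f).coeff a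

/-- The power map `a ↦ x^a`, for `a` in `ℤ/p^n`, as a monoid homomorphism. -/
noncomputable def xclPowHom (p n : ℕ) [NeZero (p ^ n)] :
    Multiplicative (ZMod (p ^ n)) →* Rring p n where
  toFun a := xcl p n ^ (Multiplicative.toAdd a).val
  map_one' := by simp
  map_mul' a b := by
    rw [toAdd_mul, ZMod.val_add, xcl_pow_mod, pow_add]

theorem eq_sum_rcoeff (f : Rring p n) :
    f = ∑ a : ZMod (p ^ n), rcoeff f a • xcl p n ^ a.val := by
  have h : ((AddMonoidAlgebra.lift ℤ (Rring p n) (ZMod (p ^ n)) (xclPowHom p n)).toRingHom.comp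
      (toGroupRing p n)) = RingHom.id _ := by
    apply Rring.ringHom_ext
    simp only [RingHom.comp_apply, toGroupRing_xcl, RingHom.id_apply]
    simp only [AlgHom.toRingHom_eq_coe, RingHom.coe_coe, AddMonoidAlgebra.lift_single, one_smul]
    simpa [xclPowHom] using xcl_pow_val_natCast p n 1
  have h2 := RingHom.congr_fun h f
  simp only [RingHom.comp_apply, RingHom.id_apply] at h2
  simp only [AlgHom.toRingHom_eq_coe, RingHom.coe_coe, AddMonoidAlgebra.lift_apply] at h2
  rw [Finsupp.sum_fintype _ _ (by simp)] at h2
  exact h2.symm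

theorem eq_zero_of_nsmul_eq_zero {N : ℕ} (hN : N ≠ 0) {f : Rring p n} (h : N • f = 0) :
    f = 0 := by
  rw [eq_sum_rcoeff f]
  refine Finset.sum_eq_zero fun a _ => ?_
  have h1 : N • toGroupRing p n f = 0 := by rw [← map_nsmul, h, map_zero]
  have h2 : N • rcoeff f a = 0 := by
    have := congrArg (fun z => AddMonoidAlgebra.coeff z a) h1
    simpa only [rcoeff, AddMonoidAlgebra.coeff_smul, AddMonoidAlgebra.coeff_zero,
      Finsupp.smul_apply, Finsupp.zero_apply] using this
  rw [(smul_eq_zero.mp h2).resolve_left hN, zero_smul]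

end

theorem rcoeff_sigmaHom {p n ℓ : ℕ} (hℓ : ℓ.Coprime (p ^ n)) (f : Rring p n)
    (a : ZMod (p ^ n)) :
    rcoeff (sigmaHom p n ℓ f) (ℓ * a) = rcoeff f a := by
  have h : (toGroupRing p n).comp (sigmaHom p n ℓ) =
      (AddMonoidAlgebra.mapDomainRingHom ℤ (AddMonoidHom.mulLeft (ℓ : ZMod (p ^ n)))).comp
        (toGroupRing p n) := by
    apply Rring.ringHom_ext
    simp [sigmaHom_xcl, toGroupRing_xcl, AddMonoidAlgebra.single_pow]
  have h2 := RingHom.congr_fun h f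
  simp only [RingHom.comp_apply] at h2
  have hinj : Function.Injective (fun b : ZMod (p ^ n) => (ℓ : ZMod (p ^ n)) * b) :=
    ((ZMod.isUnit_iff_coprime ℓ (p ^ n)).mpr hℓ).mul_right_injective
  rw [rcoeff, h2]
  exact Finsupp.mapDomain_apply hinj _ a

/-! ### Cancelling powers of `x - 1` -/

theorem exists_sub_one_mul_of_augHom_eq_zero {p n : ℕ} {f : Rring p n} (h : augHom p n f = 0) :
    ∃ g, f = (xcl p n - 1) * g := by
  obtain ⟨P, rfl⟩ := Ideal.Quotient.mk_surjective f
  have h1 : P.IsRoot 1 := by simpa [augHom] using h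
  obtain ⟨Q, rfl⟩ := Polynomial.dvd_iff_isRoot.mpr h1
  exact ⟨Ideal.Quotient.mk _ Q, by simp [xcl]⟩

section

variable {p n : ℕ} [NeZero (p ^ n)]

theorem sub_one_mul_eq_zero {h : Rring p n} (hh : (xcl p n - 1) * ((xcl p n - 1) * h) = 0) :
    (xcl p n - 1) * h = 0 := by
  set y := (xcl p n - 1) * h with hy
  have hxy : ∀ a : ℕ, xcl p n ^ a * y = y := by
    intro a
    induction a with
    | zero => simp
    | succ a ih => rw [pow_succ, mul_assoc, show xcl p n * y = y by linear_combination hh, ih]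
  refine eq_zero_of_nsmul_eq_zero (NeZero.ne (p ^ n)) ?_
  have h1 : (∑ a ∈ Finset.range (p ^ n), xcl p n ^ a) * y = p ^ n • y := by
    rw [Finset.sum_mul, Finset.sum_congr rfl fun a _ => hxy a]
    simp
  rw [← h1, hy, ← mul_assoc, geom_sum_mul, xcl_pow, sub_self, zero_mul]

theorem sub_one_mul_eq_zero_of_pow {m : ℕ} {h : Rring p n} (hh : (xcl p n - 1) ^ m * h = 0) :
    (xcl p n - 1) * h = 0 := by
  induction m generalizing h with
  | zero => rw [pow_zero, one_mul] at hh; rw [hh, mul_zero]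
  | succ m ih =>
    rw [pow_succ, mul_assoc] at hh
    exact sub_one_mul_eq_zero (ih hh)

end

/-! ### The sequence `d_j` modulo `p^n` -/

section

variable {M : Type*} [CommMonoid M]

theorem prod_range_count_nth (P : ℕ → Prop) [DecidablePred P] (g : ℕ → M) (N : ℕ) :
    ∏ i ∈ Finset.range (Nat.count P N), g (Nat.nth P i) =
      ∏ a ∈ (Finset.range N).filter P, g a := by
  induction N with
  | zero => simp
  | succ N ih =>
    by_cases hN : P N
    · rw [Nat.count_succ, if_pos hN, Finset.prod_range_succ, ih, Nat.nth_count hN,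
        Finset.range_add_one, Finset.filter_insert, if_pos hN, Finset.prod_insert (by simp),
        mul_comm]
    · rw [Nat.count_succ, if_neg hN, add_zero, ih, Finset.range_add_one, Finset.filter_insert,
        if_neg hN]

theorem prod_range_mul_of_periodic {g : ℕ → M} {q : ℕ} (hg : ∀ a, g (q + a) = g a) (c : ℕ) :
    ∏ a ∈ Finset.range (c * q), g a = (∏ a ∈ Finset.range q, g a) ^ c := by
  induction c with
  | zero => simp
  | succ c ih =>
    rw [add_one_mul, add_comm, Finset.prod_range_add, Finset.prod_congr rfl fun a _ => hg a, ih,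
      pow_succ']

theorem prod_range_filter_coprime_natCast {q : ℕ} [NeZero q] (G : ZMod q → M) :
    ∏ a ∈ (Finset.range q).filter (fun a => a.Coprime q), G a = ∏ u : (ZMod q)ˣ, G u := by
  refine Finset.prod_bij' (fun a ha => ZMod.unitOfCoprime a (Finset.mem_filter.mp ha).2)
    (fun u _ => (u : ZMod q).val) (by simp) ?_ ?_ ?_ (by simp)
  · intro u _
    exact Finset.mem_filter.mpr
      ⟨Finset.mem_range.mpr (ZMod.val_lt _), ZMod.val_coe_unit_coprime u⟩
  · intro a ha
    simp [ZMod.val_natCast, Nat.mod_eq_of_lt (Finset.mem_range.mp (Finset.mem_filter.mp ha).1)]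
  · intro u _
    ext
    simp

theorem prod_range_mul_filter_coprime_natCast {q : ℕ} [NeZero q] (G : ZMod q → M) (c : ℕ) :
    ∏ a ∈ (Finset.range (c * q)).filter (fun a => a.Coprime q), G a =
      (∏ u : (ZMod q)ˣ, G u) ^ c := by
  rw [← prod_range_filter_coprime_natCast, Finset.prod_filter, Finset.prod_filter,
    prod_range_mul_of_periodic]
  intro a
  simp

theorem card_range_mul_filter_coprime {q : ℕ} [NeZero q] (c : ℕ) :
    ((Finset.range (c * q)).filter (fun a => a.Coprime q)).card = c * q.totient := by
  have h := prod_range_mul_filter_coprime_natCast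
    (fun _ : ZMod q => Multiplicative.ofAdd (1 : ℕ)) c
  rw [Finset.prod_const, Finset.prod_const, Finset.card_univ, ZMod.card_units_eq_totient,
    ← pow_mul] at h
  have h' := congrArg Multiplicative.toAdd h
  simp only [toAdd_pow, toAdd_ofAdd, smul_eq_mul] at h'
  linarith

theorem coprime_mul_sub {q c a : ℕ} (ha : a ≤ c * q) (h : a.Coprime q) :
    (c * q - a).Coprime q := by
  rw [← ZMod.isUnit_iff_coprime] at h ⊢
  rw [Nat.cast_sub ha]
  simpa using h.neg

/-- The involution `a ↦ cq - a` on the integers in `(0, cq)` coprime to `q` has no fixed point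
unless `q ≤ 2`. -/
theorem prod_filter_coprime_eq_prod_half {q : ℕ} (hq : 2 < q) (c : ℕ) (g : ℕ → M) :
    ∏ a ∈ (Finset.range (c * q)).filter (fun a => a.Coprime q), g a =
      ∏ a ∈ (Finset.range ((c * q + 1) / 2)).filter (fun a => a.Coprime q),
        g a * g (c * q - a) := by
  have h0 : ∀ a : ℕ, a.Coprime q → a ≠ 0 := by
    rintro a ha rfl
    rw [Nat.coprime_zero_left] at ha
    omega
  have hne : ∀ a : ℕ, a.Coprime q → 2 * a ≠ c * q := by
    intro a ha h
    have := Nat.le_of_dvd two_pos (ha.symm.dvd_of_dvd_mul_right ⟨c, h.trans (mul_comm _ _)⟩)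
    omega
  rw [Finset.prod_mul_distrib,
    ← Finset.prod_filter_mul_prod_filter_not _ (fun a => 2 * a < c * q)]
  congr 1
  · refine Finset.prod_congr ?_ fun _ _ => rfl
    ext a
    simp only [Finset.mem_filter, Finset.mem_range]
    grind
  · refine Finset.prod_nbij' (fun a => c * q - a) (fun a => c * q - a) ?_ ?_ ?_ ?_ ?_
    all_goals
      intro a ha
      simp only [Finset.mem_filter, Finset.mem_range] at ha ⊢
    · have := hne a ha.1.2
      exact ⟨by omega, coprime_mul_sub (by omega) ha.1.2⟩
    · have := h0 a ha.2
      exact ⟨⟨by omega, coprime_mul_sub (by omega) ha.2⟩, by omega⟩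
    · omega
    · omega
    · rw [Nat.sub_sub_self (by omega)]

theorem prod_dseq (p : ℕ) (g : ℤ → M) (h : ℕ) :
    ∏ j ∈ Finset.Icc 1 (2 * h), g (dseq p j) =
      ∏ i ∈ Finset.range h, g (acopr p (i + 1)) * g (-(acopr p (i + 1) : ℤ)) := by
  induction h with
  | zero => simp
  | succ h ih =>
    rw [show 2 * (h + 1) = 2 * h + 1 + 1 by ring, Finset.prod_Icc_succ_top (by omega),
      Finset.prod_Icc_succ_top (by omega), ih, Finset.prod_range_succ, mul_assoc]
    congr 3
    · rw [dseq, if_pos (by omega)]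
      congr 2
      omega
    · rw [dseq, if_neg (by omega)]
      congr 3
      omega

theorem acopr_succ {p n : ℕ} (hp : p.Prime) (hn : 1 ≤ n) (i : ℕ) :
    acopr p (i + 1) = Nat.nth (fun a => a.Coprime (p ^ n)) i := by
  unfold acopr
  congr 1
  funext a
  rw [Nat.coprime_pow_right_iff (by omega)]
  refine propext ⟨And.right, fun h => ⟨Nat.pos_of_ne_zero ?_, h⟩⟩
  rintro rfl
  exact hp.one_lt.ne' ((Nat.coprime_zero_left p).mp h)

/-- If `p^{n-1} ∣ k`, then `d_1, …, d_{k(p-1)}` is equidistributed among the units modulo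
`p^n`, provided `p^n ≠ 2`. -/
theorem prod_dseq_intCast {p n c : ℕ} [NeZero (p ^ n)] (hp : p.Prime) (hn : 1 ≤ n)
    (hq : p ^ n ≠ 2) (G : ZMod (p ^ n) → M) :
    ∏ j ∈ Finset.Icc 1 (p ^ (n - 1) * c * (p - 1)), G (dseq p j) =
      (∏ u : (ZMod (p ^ n))ˣ, G u) ^ c := by
  have hq2 : 2 < p ^ n := by
    have := Nat.le_self_pow (by omega : n ≠ 0) p
    have := hp.two_le
    omega
  have hm : p ^ (n - 1) * c * (p - 1) =
      2 * Nat.count (fun a => a.Coprime (p ^ n)) ((c * p ^ n + 1) / 2) := by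
    have h := prod_filter_coprime_eq_prod_half hq2 c (fun _ => Multiplicative.ofAdd (1 : ℕ))
    rw [Finset.prod_const, Finset.prod_const, card_range_mul_filter_coprime,
      ← Nat.count_eq_card_filter_range, Nat.totient_prime_pow hp hn] at h
    have h' := congrArg Multiplicative.toAdd h
    simp only [toAdd_pow, toAdd_mul, toAdd_ofAdd, smul_eq_mul] at h'
    linarith
  rw [hm, prod_dseq p (fun d => G d), ← prod_range_mul_filter_coprime_natCast,
    prod_filter_coprime_eq_prod_half hq2, ← prod_range_count_nth]
  simp only [acopr_succ hp hn]
  have hlt : ∀ i ∈ Finset.range (Nat.count (fun a => a.Coprime (p ^ n)) ((c * p ^ n + 1) / 2)),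
      Nat.nth (fun a => a.Coprime (p ^ n)) i ≤ c * p ^ n := by
    intro i hi
    have := Nat.nth_lt_of_lt_count (Finset.mem_range.mp hi)
    omega
  refine Finset.prod_congr rfl fun i hi => ?_
  rw [Nat.cast_sub (hlt i hi)]
  simp

theorem prod_mul_dseq_intCast {p n k ℓ : ℕ} [NeZero (p ^ n)] (hp : p.Prime) (hn : 1 ≤ n)
    (hdvd : p ^ (n - 1) ∣ k) (hℓ : ℓ.Coprime p) (G : ZMod (p ^ n) → M) :
    ∏ j ∈ Finset.Icc 1 (k * (p - 1)), G (ℓ * dseq p j) =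
      ∏ j ∈ Finset.Icc 1 (k * (p - 1)), G (dseq p j) := by
  have hu : IsUnit (ℓ : ZMod (p ^ n)) :=
    (ZMod.isUnit_iff_coprime ℓ (p ^ n)).mpr (hℓ.pow_right n)
  obtain ⟨c, rfl⟩ := hdvd
  by_cases hq : p ^ n = 2
  · have h1 : (ℓ : ZMod (p ^ n)) = 1 := by
      revert hu
      generalize (ℓ : ZMod (p ^ n)) = a
      revert a
      rw [hq]
      decide
    simp only [h1, one_mul]
  · obtain ⟨v, hv⟩ := hu
    rw [prod_dseq_intCast hp hn hq, prod_dseq_intCast hp hn hq (fun a => G (ℓ * a)), ← hv]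
    congr 1
    exact Fintype.prod_equiv (Equiv.mulLeft v) _ _ fun u => by simp

end

theorem isCoprime_dseq {p : ℕ} (hp : p.Prime) (j : ℕ) : IsCoprime (dseq p j) (p : ℤ) := by
  have hinf : {a | 0 < a ∧ Nat.Coprime a p}.Infinite := by
    refine Set.infinite_of_injective_forall_mem (f := fun i : ℕ => p * i + 1) ?_ ?_
    · intro a b hab
      exact Nat.eq_of_mul_eq_mul_left hp.pos (Nat.succ_injective hab)
    · intro i
      exact ⟨Nat.succ_pos _, by simp⟩
  have h : ∀ t, IsCoprime (acopr p t : ℤ) (p : ℤ) := fun t =>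
    Nat.isCoprime_iff_coprime.mpr (Nat.nth_mem_of_infinite hinf (t - 1)).2
  unfold dseq
  split_ifs
  · exact h _
  · exact (h _).neg_left

/-! ### The Euler class quotient acts trivially on the augmentation ideal -/

theorem xz_natCast_mul {p n : ℕ} (hp : 0 < p) (i : ℕ) (d : ℤ) :
    xz p n hp (i * d) = xz p n hp d ^ i := by
  rw [xz, mul_comm, zpow_mul, zpow_natCast, Units.val_pow_eq_pow_val, xz]

section

variable {p n : ℕ} [NeZero (p ^ n)]

theorem xz_eq_xcl_pow_val (hp : 0 < p) (d : ℤ) :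
    xz p n hp d = xcl p n ^ (d : ZMod (p ^ n)).val := by
  have h1 : xunit p n hp ^ p ^ n = 1 := Units.ext (xcl_pow p n)
  have h2 : xunit p n hp ^ d = xunit p n hp ^ (d : ZMod (p ^ n)).val := by
    rw [← zpow_natCast, ZMod.val_intCast]
    conv_lhs => rw [← Int.emod_add_mul_ediv d ((p ^ n : ℕ) : ℤ), zpow_add, zpow_mul,
      zpow_natCast, h1, one_zpow, mul_one]
  rw [xz, h2]
  rfl

/-- `x^d - 1` divides `x - 1` when `d` is coprime to `p`. -/
theorem xz_sub_one_dvd (hp : 0 < p) {d : ℤ} (hd : IsCoprime d (p : ℤ)) :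
    xz p n hp d - 1 ∣ xcl p n - 1 := by
  have hu : IsUnit (d : ZMod (p ^ n)) := by
    obtain ⟨a, b, hab⟩ := hd.pow_right (n := n)
    refine IsUnit.of_mul_eq_one (a : ZMod (p ^ n)) ?_
    have := congrArg (fun z : ℤ => (z : ZMod (p ^ n))) hab
    have h0 : ((p : ZMod (p ^ n)) ^ n) = 0 := by exact_mod_cast ZMod.natCast_self (p ^ n)
    push_cast at this
    rw [h0, mul_zero, add_zero] at this
    rw [mul_comm, this]
  obtain ⟨e, he⟩ := hu.exists_left_inv
  have h1 : xz p n hp d ^ e.val = xcl p n := by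
    rw [← xz_natCast_mul, xz_eq_xcl_pow_val]
    have : ((((e.val : ℤ) * d : ℤ)) : ZMod (p ^ n)) = ((1 : ℕ) : ZMod (p ^ n)) := by
      push_cast
      rw [ZMod.natCast_zmod_val, he]
    rw [this, xcl_pow_val_natCast, pow_one]
  have h2 := sub_one_dvd_pow_sub_one (xz p n hp d) e.val
  rwa [h1] at h2

theorem sub_one_mul_useq {k ℓ : ℕ} (hp : p.Prime) (hn : 1 ≤ n) (hdvd : p ^ (n - 1) ∣ k)
    (hℓ : ℓ.Coprime p) :
    (xcl p n - 1) * useq p n hp.pos ℓ (k * (p - 1)) = xcl p n - 1 := by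
  set m := k * (p - 1)
  set E : Rring p n := ∏ j ∈ Finset.Icc 1 m, (xz p n hp.pos (dseq p j) - 1) with hE
  have hEu : E * useq p n hp.pos ℓ m = E := by
    have h1 : E * useq p n hp.pos ℓ m =
        ∏ j ∈ Finset.Icc 1 m, (xz p n hp.pos (ℓ * dseq p j) - 1) := by
      rw [hE, useq, ← Finset.prod_mul_distrib]
      refine Finset.prod_congr rfl fun j _ => ?_
      simp only [xz_natCast_mul]
      rw [mul_geom_sum]
    rw [h1, hE]
    have h2 := prod_mul_dseq_intCast hp hn hdvd hℓ
      (fun a : ZMod (p ^ n) => xcl p n ^ a.val - 1)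
    simp only [xz_eq_xcl_pow_val]
    push_cast
    exact h2
  have hdv : E ∣ (xcl p n - 1) ^ m := by
    have h := Finset.prod_dvd_prod_of_dvd (s := Finset.Icc 1 m)
      (fun j => xz p n hp.pos (dseq p j) - 1) (fun _ => xcl p n - 1)
      (fun j _ => xz_sub_one_dvd hp.pos (isCoprime_dseq hp j))
    simpa using h
  obtain ⟨s, hs⟩ := hdv
  have h := sub_one_mul_eq_zero_of_pow (m := m) (h := useq p n hp.pos ℓ m - 1)
    (by rw [hs]; linear_combination s * hEu)
  linear_combination h

end

theorem augHom_sigmaHom (p n ℓ : ℕ) (f : Rring p n) :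
    augHom p n (sigmaHom p n ℓ f) = augHom p n f := by
  have h : (augHom p n).comp (sigmaHom p n ℓ) = augHom p n :=
    Rring.ringHom_ext (by simp [sigmaHom_xcl, augHom_xcl])
  exact RingHom.congr_fun h f

theorem augHom_useq {p n : ℕ} (hp : 0 < p) (ℓ m : ℕ) :
    augHom p n (useq p n hp ℓ m) = (ℓ : ℤ) ^ m := by
  have : NeZero (p ^ n) := ⟨(pow_pos hp n).ne'⟩
  simp [useq, xz_eq_xcl_pow_val, augHom_xcl]

theorem sigmaHom_mul_useq_of_augHom_eq_zero {p n k ℓ : ℕ} (hp : p.Prime) (hn : 1 ≤ n)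
    (hdvd : p ^ (n - 1) ∣ k) (hℓ : ℓ.Coprime p) {f : Rring p n} (hf : augHom p n f = 0) :
    sigmaHom p n ℓ f * useq p n hp.pos ℓ (k * (p - 1)) = sigmaHom p n ℓ f := by
  have : NeZero (p ^ n) := ⟨(pow_pos hp.pos n).ne'⟩
  obtain ⟨g, hg⟩ := exists_sub_one_mul_of_augHom_eq_zero ((augHom_sigmaHom p n ℓ f).trans hf)
  rw [hg, mul_right_comm, sub_one_mul_useq hp hn hdvd hℓ]

/-! ### The elements invariant under `σ_ℓ` -/

theorem Tel_eq_sum_filter {p n i : ℕ} (hp : 0 < p) (hi : i ≤ n) :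
    Tel p n i = ∑ a ∈ (Finset.range (p ^ n)).filter (fun a => p ^ i ∣ a), xcl p n ^ a := by
  have hpi : 0 < p ^ i := pow_pos hp i
  have hpn : p ^ n = p ^ (n - i) * p ^ i := by rw [← pow_add, Nat.sub_add_cancel hi]
  rw [Tel]
  refine Finset.sum_nbij' (fun t => t * p ^ i) (fun a => a / p ^ i) ?_ ?_ ?_ ?_ (by simp)
  · intro t ht
    rw [Finset.mem_filter, Finset.mem_range, hpn]
    exact ⟨Nat.mul_lt_mul_of_pos_right (Finset.mem_range.mp ht) hpi, dvd_mul_left _ _⟩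
  · intro a ha
    rw [Finset.mem_filter, Finset.mem_range, hpn] at ha
    exact Finset.mem_range.mpr (Nat.div_lt_of_lt_mul (by rw [mul_comm]; exact ha.1))
  · intro t _
    exact Nat.mul_div_cancel t hpi
  · intro a ha
    exact Nat.div_mul_cancel (Finset.mem_filter.mp ha).2

theorem augHom_Tel (p n i : ℕ) : augHom p n (Tel p n i) = (p : ℤ) ^ (n - i) := by
  simp [Tel, augHom_xcl]

theorem Tel_self (p n : ℕ) : Tel p n n = 1 := by
  simp [Tel]

theorem augHom_Zel {p n i : ℕ} (h1 : 1 ≤ i) (hi : i ≤ n) : augHom p n (Zel p n i) = 0 := by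
  rw [Zel, if_neg (by omega), map_sub, map_mul, map_natCast, augHom_Tel, augHom_Tel,
    show n - (i - 1) = n - i + 1 by omega, pow_succ']
  ring

theorem sigmaHom_Tel {p n i ℓ : ℕ} (hp : 0 < p) (hi : i ≤ n) (hℓ : ℓ.Coprime p) :
    sigmaHom p n ℓ (Tel p n i) = Tel p n i := by
  have : NeZero (p ^ (n - i)) := ⟨(pow_pos hp _).ne'⟩
  have hper : ∀ a, xcl p n ^ (a % p ^ (n - i) * p ^ i) = xcl p n ^ (a * p ^ i) := by
    intro a
    rw [← xcl_pow_mod, ← xcl_pow_mod p n (a * p ^ i)]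
    conv_rhs => rw [← Nat.mod_add_div a (p ^ (n - i)), add_mul, mul_right_comm, ← pow_add,
      Nat.sub_add_cancel hi, Nat.add_mul_mod_self_left]
  have hT : Tel p n i = ∑ a : ZMod (p ^ (n - i)), xcl p n ^ (a.val * p ^ i) := by
    rw [Tel]
    refine Finset.sum_nbij' (fun a => (a : ZMod (p ^ (n - i)))) ZMod.val (by simp)
      (by simp [ZMod.val_lt]) ?_ (by simp) ?_
    · intro a ha
      exact ZMod.val_cast_of_lt (Finset.mem_range.mp ha)
    · intro a _
      rw [ZMod.val_natCast, hper]
  obtain ⟨v, hv⟩ := (ZMod.isUnit_iff_coprime ℓ (p ^ (n - i))).mpr (hℓ.pow_right _)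
  rw [hT, map_sum]
  refine Fintype.sum_equiv v.mulLeft _ _ fun a => ?_
  rw [map_pow, sigmaHom_xcl, Units.mulLeft_apply, hv, ZMod.val_mul, hper, ← pow_mul,
    ZMod.val_natCast, ← mul_assoc, ← hper (ℓ * _),
    ← hper (ℓ % _ * _), Nat.mod_mul_mod]

theorem sigmaHom_Zel {p n i ℓ : ℕ} (hp : 0 < p) (hi : i ≤ n) (hℓ : ℓ.Coprime p) :
    sigmaHom p n ℓ (Zel p n i) = Zel p n i := by
  unfold Zel
  split_ifs
  · rw [map_mul, map_natCast, sigmaHom_Tel hp (Nat.zero_le n) hℓ]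
  · rw [map_sub, map_mul, map_natCast, sigmaHom_Tel hp hi hℓ, sigmaHom_Tel hp (by omega) hℓ]

/-- Every natural number is congruent modulo `p^n` to a unit times a power of `p`. -/
theorem exists_coprime_mul_pow {p : ℕ} (hp : p.Prime) (n a : ℕ) :
    ∃ v b : ℕ, v ≤ n ∧ b.Coprime p ∧ (a : ZMod (p ^ n)) = b * (p ^ v : ℕ) ∧
      ∀ i ≤ n, (p ^ i ∣ a ↔ i ≤ v) := by
  by_cases h : p ^ n ∣ a
  · refine ⟨n, 1, le_rfl, Nat.coprime_one_left p, ?_, fun i hi => ?_⟩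
    · rw [(ZMod.natCast_eq_zero_iff _ _).mpr h, ZMod.natCast_self, mul_zero]
    · exact iff_of_true ((pow_dvd_pow p hi).trans h) hi
  · have ha : a ≠ 0 := by
      rintro rfl
      exact h (dvd_zero _)
    obtain ⟨v, b, hb, rfl⟩ := Nat.exists_eq_pow_mul_and_not_dvd ha p hp.ne_one
    refine ⟨v, b, ?_, ((Nat.Prime.coprime_iff_not_dvd hp).mpr hb).symm, by push_cast; ring,
      fun i _ => ⟨fun hi => ?_, fun hi => (pow_dvd_pow p hi).mul_right b⟩⟩
    · by_contra! hv
      exact h ((pow_dvd_pow p hv.le).mul_right b)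
    · exact (Nat.pow_dvd_pow_iff_le_right hp.one_lt).mp
        ((((Nat.Prime.coprime_iff_not_dvd hp).mpr hb).pow_left i).dvd_of_dvd_mul_right hi)

theorem mem_span_Tel_of_sigmaHom_eq {p n : ℕ} (hp : p.Prime) {f : Rring p n}
    (hf : ∀ ℓ : ℕ, 1 ≤ ℓ → ℓ.Coprime p → sigmaHom p n ℓ f = f) :
    f ∈ Submodule.span ℤ (Tel p n '' Set.Iic n) := by
  have : NeZero (p ^ n) := ⟨(pow_pos hp.pos n).ne'⟩
  set c : ℕ → ℤ := fun i => rcoeff f (p ^ i : ℕ)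
  have key : f = c 0 • Tel p n 0 + ∑ i ∈ Finset.range n, (c (i + 1) - c i) • Tel p n (i + 1) := by
    have hsum : f = ∑ a ∈ Finset.range (p ^ n), rcoeff f a • xcl p n ^ a := by
      conv_lhs => rw [eq_sum_rcoeff f]
      symm
      refine Finset.sum_nbij' (fun a => (a : ZMod (p ^ n))) ZMod.val (by simp)
        (by simp [ZMod.val_lt]) ?_ (by simp) ?_
      · intro a ha
        exact ZMod.val_cast_of_lt (Finset.mem_range.mp ha)
      · intro a _
        rw [xcl_pow_val_natCast]
    have hT : ∀ i ≤ n, Tel p n i = ∑ a ∈ Finset.range (p ^ n),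
        (if p ^ i ∣ a then (1 : ℤ) else 0) • xcl p n ^ a := by
      intro i hi
      rw [Tel_eq_sum_filter hp.pos hi, Finset.sum_filter]
      refine Finset.sum_congr rfl fun a _ => ?_
      split_ifs <;> simp
    have hT' : ∑ i ∈ Finset.range n, (c (i + 1) - c i) • Tel p n (i + 1) =
        ∑ a ∈ Finset.range (p ^ n), (∑ i ∈ Finset.range n,
          (c (i + 1) - c i) * (if p ^ (i + 1) ∣ a then (1 : ℤ) else 0)) • xcl p n ^ a := by
      simp only [Finset.sum_smul]
      rw [Finset.sum_comm]
      refine Finset.sum_congr rfl fun i hi => ?_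
      rw [hT (i + 1) (Finset.mem_range.mp hi), Finset.smul_sum]
      simp only [mul_smul]
    rw [hT', hT 0 (Nat.zero_le n), Finset.smul_sum, ← Finset.sum_add_distrib]
    conv_lhs => rw [hsum]
    refine Finset.sum_congr rfl fun a _ => ?_
    rw [smul_smul, ← add_smul]
    congr 1
    obtain ⟨v, b, hv, hb, hab, hdiv⟩ := exists_coprime_mul_pow hp n a
    have hb1 : 1 ≤ b := Nat.one_le_iff_ne_zero.mpr (by
      rintro rfl
      exact hp.one_lt.ne' ((Nat.coprime_zero_left p).mp hb))
    have hca : rcoeff f a = c v := by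
      rw [hab]
      conv_lhs => rw [← hf b hb1 hb]
      exact rcoeff_sigmaHom (hb.pow_right n) f _
    have hsv : ∑ i ∈ Finset.range n,
        (c (i + 1) - c i) * (if p ^ (i + 1) ∣ a then (1 : ℤ) else 0) =
        ∑ i ∈ Finset.range v, (c (i + 1) - c i) := by
      simp only [mul_ite, mul_one, mul_zero]
      rw [← Finset.sum_filter]
      refine Finset.sum_congr ?_ fun _ _ => rfl
      ext i
      simp only [Finset.mem_filter, Finset.mem_range]
      constructor
      · rintro ⟨hi, hd⟩
        exact (hdiv (i + 1) hi).mp hd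
      · intro hi
        exact ⟨by omega, (hdiv (i + 1) (by omega)).mpr hi⟩
    rw [hca, hsv, Finset.sum_range_sub, pow_zero, if_pos (one_dvd a)]
    ring
  rw [key]
  refine add_mem (Submodule.smul_mem _ _ (Submodule.subset_span ⟨0, Nat.zero_le n, rfl⟩))
    (sum_mem fun i hi => Submodule.smul_mem _ _ (Submodule.subset_span ⟨i + 1, ?_, rfl⟩))
  exact Finset.mem_range.mp hi

theorem Tel_sub_augHom_mem_span_Zel {p n : ℕ} {i : ℕ} (hi : i ≤ n) :
    Tel p n i - (augHom p n (Tel p n i) : Rring p n) ∈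
      Submodule.span ℤ ((fun i => Zel p n i) '' Set.Icc 1 n) := by
  induction hi using Nat.decreasingInduction with
  | self => simp [Tel_self]
  | of_succ i hi ih =>
    have hZ : Zel p n (i + 1) ∈ Submodule.span ℤ ((fun i => Zel p n i) '' Set.Icc 1 n) :=
      Submodule.subset_span ⟨i + 1, ⟨by omega, hi⟩, rfl⟩
    have h := sub_mem (Submodule.smul_mem _ (p : ℤ) ih) hZ
    convert h using 1
    rw [augHom_Tel, augHom_Tel, show n - i = n - (i + 1) + 1 by omega, Zel,
      if_neg (Nat.succ_ne_zero i), Nat.add_sub_cancel, zsmul_eq_mul]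
    push_cast
    ring

theorem mem_span_Zel_of_mem_span_Tel {p n : ℕ} {f : Rring p n}
    (hf : f ∈ Submodule.span ℤ (Tel p n '' Set.Iic n)) (h0 : augHom p n f = 0) :
    f ∈ Submodule.span ℤ ((fun i => Zel p n i) '' Set.Icc 1 n) := by
  suffices h : f - (augHom p n f : Rring p n) ∈
      Submodule.span ℤ ((fun i => Zel p n i) '' Set.Icc 1 n) by
    simpa [h0] using h
  clear h0
  induction hf using Submodule.span_induction with
  | mem x hx =>
    obtain ⟨i, hi, rfl⟩ := hx
    exact Tel_sub_augHom_mem_span_Zel hi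
  | zero => simp
  | add x y _ _ hx hy =>
    convert add_mem hx hy using 1
    rw [map_add]
    push_cast
    ring
  | smul a x _ hx =>
    convert Submodule.smul_mem _ a hx using 1
    rw [zsmul_eq_mul, zsmul_eq_mul, map_mul, map_intCast]
    push_cast
    ring

/-- For `p^{n-1} ∣ k`, `k ≥ 1`, the subgroup of `π_{0,2k(p-1)}KU_{C_{p^n}} ≅ R_n·β_{k(p-1)}`
fixed by all Adams operations `ψ^ℓ` with `p ∤ ℓ` is `I(C_{p^n})·β_{k(p-1)}`: the set of
`f ∈ R_n` with `ψ_m^{(ℓ)}(f) = f` for all `ℓ ≥ 1` coprime to `p` (where `m = k(p-1)`)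
equals the ℤ-span of `{Z_1, …, Z_n}`. -/
theorem stmt11 (p n k : ℕ) (hp : p.Prime) (hn : 1 ≤ n) (hk : 1 ≤ k)
    (hdvd : p ^ (n - 1) ∣ k) :
    {f : Rring p n | ∀ ℓ : ℕ, 1 ≤ ℓ → Nat.Coprime ℓ p →
        sigmaHom p n ℓ f * useq p n hp.pos ℓ (k * (p - 1)) = f}
      = ↑(Submodule.span ℤ ((fun i => Zel p n i) '' Set.Icc 1 n)) := by
  ext f
  simp only [Set.mem_ofPred_eq, SetLike.mem_coe]
  constructor
  · intro hf
    have h0 : augHom p n f = 0 := by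
      have h := congrArg (augHom p n) (hf (p + 1) (by omega) (by simp))
      rw [map_mul, augHom_sigmaHom, augHom_useq] at h
      have hm : k * (p - 1) ≠ 0 := Nat.mul_ne_zero (by omega) (by have := hp.two_le; omega)
      have hgt : (1 : ℤ) < ((p + 1 : ℕ) : ℤ) ^ (k * (p - 1)) :=
        one_lt_pow₀ (by have := hp.pos; push_cast; omega) hm
      have h' : augHom p n f * (((p + 1 : ℕ) : ℤ) ^ (k * (p - 1)) - 1) = 0 := by
        linear_combination h
      exact (mul_eq_zero.mp h').resolve_right (by omega)
    refine mem_span_Zel_of_mem_span_Tel (mem_span_Tel_of_sigmaHom_eq hp fun ℓ h1 hℓ => ?_) h0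
    rw [← sigmaHom_mul_useq_of_augHom_eq_zero hp hn hdvd hℓ h0]
    exact hf ℓ h1 hℓ
  · intro hf ℓ _ hℓ
    induction hf using Submodule.span_induction with
    | mem x hx =>
      obtain ⟨i, ⟨hi1, hin⟩, rfl⟩ := hx
      rw [sigmaHom_mul_useq_of_augHom_eq_zero hp hn hdvd hℓ (augHom_Zel hi1 hin),
        sigmaHom_Zel hp.pos hin hℓ]
    | zero => simp
    | add x y _ _ hx hy => rw [map_add, add_mul, hx, hy]
    | smul a x _ hx => rw [map_zsmul, smul_mul_assoc, hx]
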